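/- arXiv:2202.05192 — 2 statements merged into one kernel-verified Lean document; each statement's English description precedes it below -/
import Mathlib

section
/- Let y and z be von Mises–Fisher random vectors on S_p with parameters (κ_y, μ_y) and (κ_z, μ_z), and set κ_χ = ‖2κ_y μ_y − κ_z μ_z‖₂. If κ_χ > 0, then the χ-square distance of y from z equals d_χ(y,z) = κ_y^{2ν}·I_ν(κ_χ)·I_ν(κ_z)/(κ_χ^ν·κ_z^ν·I_ν(κ_y)²) − 1. -/
open MeasureTheory Real
open scoped RealInnerProductSpace

/-- `ν = p/2 − 1`. -/
noncomputable def nuOf (p : ℕ) : ℝ := (p : ℝ) / 2 - 1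

/-- The modified Bessel function of the first kind,
`I_ν(z) = (z/2)^ν ∑_{k=0}^∞ (z/2)^{2k}/(k!·Γ(ν+k+1))`. -/
noncomputable def besselI (ν z : ℝ) : ℝ :=
  (z / 2) ^ ν * ∑' k : ℕ, (z / 2) ^ (2 * k) / (Nat.factorial k * Real.Gamma (ν + k + 1))

/-- The ratio of modified Bessel functions `r_ν(κ) = I_{ν+1}(κ)/I_ν(κ)`. -/
noncomputable def besselRatio (ν κ : ℝ) : ℝ := besselI (ν + 1) κ / besselI ν κ

/-- The standard surface measure on the unit sphere in `ℝ^p`. -/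
noncomputable def sphereMeasure (p : ℕ) :
    Measure (Metric.sphere (0 : EuclideanSpace ℝ (Fin p)) 1) :=
  (volume : Measure (EuclideanSpace ℝ (Fin p))).toSphere

/-- The von Mises–Fisher partition function `C_ν(κ) = (2π)^{ν+1} I_ν(κ)/κ^ν`. -/
noncomputable def vmfC (ν κ : ℝ) : ℝ := (2 * Real.pi) ^ (ν + 1) * besselI ν κ / κ ^ ν

/-- The von Mises–Fisher density `f_p(x;κ,μ) = exp(κ⟨μ,x⟩)/C_ν(κ)`. -/
noncomputable def vmf (p : ℕ) (κ : ℝ) (μ x : EuclideanSpace ℝ (Fin p)) : ℝ :=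
  Real.exp (κ * ⟪μ, x⟫) / vmfC (nuOf p) κ

/-- The uniform density on the unit sphere in `ℝ^p`, `u(x) = Γ(ν+1)/(2π^{ν+1})`. -/
noncomputable def uniformDensity (p : ℕ) : ℝ :=
  Real.Gamma (nuOf p + 1) / (2 * Real.pi ^ (nuOf p + 1))

/-- The χ-square distance of `f_p(·;κ_y,μ_y)` from `f_p(·;κ_z,μ_z)`. -/
noncomputable def chiSqDist (p : ℕ) (κy κz : ℝ) (μy μz : EuclideanSpace ℝ (Fin p)) : ℝ :=
  (∫ x : Metric.sphere (0 : EuclideanSpace ℝ (Fin p)) 1,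
      vmf p κy μy (x : EuclideanSpace ℝ (Fin p)) ^ 2
        / vmf p κz μz (x : EuclideanSpace ℝ (Fin p)) ∂(sphereMeasure p)) - 1

lemma vmfaux_gamma (k : ℕ) :
    Real.Gamma (k + 1 / 2) * (4 ^ k * (k.factorial : ℝ)) = ((2 * k).factorial : ℝ) * √π := by
  induction k with
  | zero => simpa using Real.Gamma_one_half_eq
  | succ k ih =>
    have h1 : ((k + 1 : ℕ) : ℝ) + 1 / 2 = (k + 1 / 2 : ℝ) + 1 := by push_cast; ring
    rw [h1, Real.Gamma_add_one (by positivity)]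
    have h2 : 2 * (k + 1) = (2 * k + 1) + 1 := by ring
    rw [h2, Nat.factorial_succ, Nat.factorial_succ, Nat.factorial_succ, pow_succ]
    push_cast
    calc _ = (k + 1 / 2 : ℝ) * 4 * (k + 1) * (Real.Gamma (k + 1 / 2) * (4 ^ k * (k.factorial : ℝ))) := by ring
      _ = _ := by rw [ih]; ring

lemma vmfaux_radial (n : ℕ) :
    ∫ r in Set.Ioi (0 : ℝ), r ^ n * Real.exp (-r ^ 2) = Real.Gamma (((n : ℝ) + 1) / 2) / 2 := by
  have h := integral_rpow_mul_exp_neg_mul_rpow (p := 2) (q := n) (b := 1) (by norm_num)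
    (by have : (0:ℝ) ≤ n := by positivity
        linarith) one_pos
  simp only [Real.rpow_natCast, Real.rpow_two, Real.one_rpow, one_mul, neg_mul] at h
  rw [h]; ring

lemma vmfaux_even (k : ℕ) :
    ∫ t : ℝ, t ^ (2 * k) * Real.exp (-t ^ 2) = Real.Gamma ((k : ℝ) + 1 / 2) := by
  have h := integral_comp_abs (f := fun t : ℝ => t ^ (2 * k) * Real.exp (-t ^ 2))
  rw [vmfaux_radial] at h
  have e : ∀ t : ℝ, |t| ^ (2 * k) = t ^ (2 * k) := fun t => by rw [pow_mul, sq_abs, ← pow_mul]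
  simp only [e, sq_abs] at h
  rw [h]
  have : (((2 * k : ℕ) : ℝ) + 1) / 2 = (k : ℝ) + 1 / 2 := by push_cast; ring
  rw [this]; ring

lemma vmfaux_odd (n : ℕ) (hn : Odd n) :
    ∫ t : ℝ, t ^ n * Real.exp (-t ^ 2) = 0 := by
  have h := integral_neg_eq_self (fun t : ℝ => t ^ n * Real.exp (-t ^ 2)) volume
  simp only [hn.neg_pow, neg_sq, neg_mul, integral_neg] at h
  linarith

lemma vmfaux_gauss1 : ∫ t : ℝ, Real.exp (-t ^ 2) = √π := by
  simpa using integral_gaussian 1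

lemma vmfaux_gauss (p : ℕ) (hp : 0 < p) (a : EuclideanSpace ℝ (Fin p)) (ha : a ≠ 0) (n : ℕ) :
    ∫ x : EuclideanSpace ℝ (Fin p), ⟪a, x⟫ ^ n * Real.exp (-‖x‖ ^ 2)
      = ‖a‖ ^ n * (∫ t : ℝ, t ^ n * Real.exp (-t ^ 2)) * √π ^ (p - 1) := by
  have hna : ‖a‖ ≠ 0 := norm_ne_zero_iff.mpr ha
  let i0 : Fin p := ⟨0, hp⟩
  obtain ⟨b, hb⟩ := Orthonormal.exists_orthonormalBasis_extension_of_card_eq (𝕜 := ℝ)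
    (E := EuclideanSpace ℝ (Fin p)) (ι := Fin p) (by simp) (v := fun _ => ‖a‖⁻¹ • a) (s := {i0})
    (by
      constructor
      · rintro ⟨i, hi⟩
        simp [Set.domRestrict, norm_smul, hna]
      · rintro ⟨i, hi⟩ ⟨j, hj⟩ hij
        exact absurd (Subtype.ext ((Set.mem_singleton_iff.mp hi).trans
          (Set.mem_singleton_iff.mp hj).symm)) hij)
  have hb0 : a = ‖a‖ • b i0 := by
    rw [hb i0 rfl, smul_smul, mul_inv_cancel₀ hna, one_smul]
  have h1 : ∀ x, ⟪a, x⟫ = ‖a‖ * b.repr x i0 := by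
    intro x
    conv_lhs => rw [hb0]
    rw [real_inner_smul_left, b.repr_apply_apply]
  have h2 : ∀ x, ⟪a, x⟫ ^ n * Real.exp (-‖x‖ ^ 2)
      = ‖a‖ ^ n * ((b.repr x i0) ^ n * Real.exp (-‖b.repr x‖ ^ 2)) := by
    intro x
    rw [h1, b.repr.norm_map]; ring
  simp_rw [h2]
  rw [integral_const_mul, mul_assoc]
  congr 1
  rw [(b.measurePreserving_repr).integral_comp b.repr.toHomeomorph.measurableEmbedding
    (fun y : EuclideanSpace ℝ (Fin p) => (y i0) ^ n * Real.exp (-‖y‖ ^ 2))]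
  rw [← (PiLp.volume_preserving_toLp (Fin p)).integral_comp
    (MeasurableEquiv.toLp 2 (Fin p → ℝ)).measurableEmbedding]
  have h3 : ∀ y : Fin p → ℝ, ((WithLp.toLp 2 y : EuclideanSpace ℝ (Fin p)) i0) ^ n
        * Real.exp (-‖(WithLp.toLp 2 y : EuclideanSpace ℝ (Fin p))‖ ^ 2)
      = ∏ i, ((if i = i0 then (y i) ^ n else 1) * Real.exp (-(y i) ^ 2)) := by
    intro y
    rw [Finset.prod_mul_distrib, ← Real.exp_sum, EuclideanSpace.real_norm_sq_eq]
    simp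
  refine (integral_congr_ae (Filter.Eventually.of_forall h3)).trans ?_
  rw [integral_fintype_prod_volume_eq_prod
    (fun i (t : ℝ) => (if i = i0 then t ^ n else 1) * Real.exp (-t ^ 2))]
  rw [← Finset.mul_prod_erase _ _ (Finset.mem_univ i0)]
  simp only [if_true]
  congr 1
  rw [Finset.prod_congr rfl (g := fun _ => √π)]
  · simp
  · intro i hi
    simp [(Finset.mem_erase.mp hi).1, vmfaux_gauss1]

lemma vmfaux_polar (p : ℕ) (hp : 0 < p) (a : EuclideanSpace ℝ (Fin p)) (n : ℕ) :
    ∫ x : EuclideanSpace ℝ (Fin p), ⟪a, x⟫ ^ n * Real.exp (-‖x‖ ^ 2)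
      = (∫ x : Metric.sphere (0 : EuclideanSpace ℝ (Fin p)) 1,
          ⟪a, (x : EuclideanSpace ℝ (Fin p))⟫ ^ n ∂(sphereMeasure p))
        * (Real.Gamma (((n : ℝ) + p) / 2) / 2) := by
  calc
    _ = ∫ x : ({(0)}ᶜ : Set (EuclideanSpace ℝ (Fin p))),
          ⟪a, x.1⟫ ^ n * Real.exp (-‖x.1‖ ^ 2) 
          ∂((volume : Measure (EuclideanSpace ℝ (Fin p))).comap (Subtype.val : ({(0)}ᶜ : Set (EuclideanSpace ℝ (Fin p))) → EuclideanSpace ℝ (Fin p))) := by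
      haveI : Nonempty (Fin p) := ⟨⟨0, hp⟩⟩
      rw [integral_subtype_comap (measurableSet_singleton _).compl
        fun x : EuclideanSpace ℝ (Fin p) ↦ ⟪a, x⟫ ^ n * Real.exp (-‖x‖ ^ 2),
        restrict_compl_singleton]
    _ = ∫ z : Metric.sphere (0 : EuclideanSpace ℝ (Fin p)) 1 × Set.Ioi (0 : ℝ),
          (⟪a, (z.1 : EuclideanSpace ℝ (Fin p))⟫ ^ n) * ((z.2 : ℝ) ^ n * Real.exp (-(z.2 : ℝ) ^ 2))
          ∂((volume : Measure (EuclideanSpace ℝ (Fin p))).toSphere.prod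
            (.volumeIoiPow (Module.finrank ℝ (EuclideanSpace ℝ (Fin p)) - 1))) := by
      rw [← (volume : Measure (EuclideanSpace ℝ (Fin p))).measurePreserving_homeomorphUnitSphereProd.integral_comp
        (Homeomorph.measurableEmbedding _)]
      refine integral_congr_ae (Filter.Eventually.of_forall fun x => ?_)
      have hx : ‖x.1‖ ≠ 0 := norm_ne_zero_iff.mpr x.2
      simp only [homeomorphUnitSphereProd_apply_fst_coe, homeomorphUnitSphereProd_apply_snd_coe,
        real_inner_smul_right]
      rw [mul_pow, inv_pow]
      field_simp
    _ = (∫ x : Metric.sphere (0 : EuclideanSpace ℝ (Fin p)) 1,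
          ⟪a, (x : EuclideanSpace ℝ (Fin p))⟫ ^ n ∂(sphereMeasure p))
        * ∫ r : Set.Ioi (0 : ℝ), (r : ℝ) ^ n * Real.exp (-(r : ℝ) ^ 2)
          ∂(.volumeIoiPow (Module.finrank ℝ (EuclideanSpace ℝ (Fin p)) - 1)) :=
      integral_prod_mul
        (fun x : Metric.sphere (0 : EuclideanSpace ℝ (Fin p)) 1 =>
          ⟪a, (x : EuclideanSpace ℝ (Fin p))⟫ ^ n)
        (fun r : Set.Ioi (0 : ℝ) => (r : ℝ) ^ n * Real.exp (-(r : ℝ) ^ 2))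
    _ = _ := by
      congr 1
      simp only [Measure.volumeIoiPow, ENNReal.ofReal, finrank_euclideanSpace, Fintype.card_fin]
      rw [integral_withDensity_eq_integral_smul,
        integral_subtype_comap measurableSet_Ioi
          fun r : ℝ ↦ Real.toNNReal (r ^ (p - 1)) • (r ^ n * Real.exp (-r ^ 2)),
        setIntegral_congr_fun (g := fun r : ℝ => r ^ (n + (p - 1)) * Real.exp (-r ^ 2))
          measurableSet_Ioi fun x hx ↦ ?_]
      · rw [vmfaux_radial]
        push_cast [Nat.cast_sub (show 1 ≤ p from hp)]
        ring_nf
      · simp only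
        rw [NNReal.smul_def, Real.coe_toNNReal _ (pow_nonneg (le_of_lt hx) _), smul_eq_mul]
        ring
      · exact (measurable_subtype_coe.pow_const _).real_toNNReal

lemma vmfaux_moment_odd (p : ℕ) (hp : 0 < p) (a : EuclideanSpace ℝ (Fin p)) (ha : a ≠ 0) (n : ℕ)
    (hn : Odd n) :
    ∫ x : Metric.sphere (0 : EuclideanSpace ℝ (Fin p)) 1,
          ⟪a, (x : EuclideanSpace ℝ (Fin p))⟫ ^ n ∂(sphereMeasure p) = 0 := by
  have h := vmfaux_polar p hp a n
  rw [vmfaux_gauss p hp a ha, vmfaux_odd n hn, mul_zero, zero_mul] at h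
  have hp' : (0 : ℝ) < p := by exact_mod_cast hp
  have hg : 0 < Real.Gamma (((n : ℝ) + p) / 2) := Real.Gamma_pos_of_pos (by positivity)
  rcases mul_eq_zero.mp h.symm with h | h
  · exact h
  · linarith

lemma vmfaux_moment_even (p : ℕ) (hp : 0 < p) (a : EuclideanSpace ℝ (Fin p)) (ha : a ≠ 0) (k : ℕ) :
    (∫ x : Metric.sphere (0 : EuclideanSpace ℝ (Fin p)) 1,
          ⟪a, (x : EuclideanSpace ℝ (Fin p))⟫ ^ (2 * k) ∂(sphereMeasure p)) / ((2 * k).factorial : ℝ)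
      = 2 * π ^ ((p : ℝ) / 2) * ((‖a‖ / 2) ^ (2 * k)
          / (k.factorial * Real.Gamma (nuOf p + k + 1))) := by
  have h := vmfaux_polar p hp a (2 * k)
  rw [vmfaux_gauss p hp a ha, vmfaux_even] at h
  have hp' : (0 : ℝ) < p := by exact_mod_cast hp
  have e : (((2 * k : ℕ) : ℝ) + p) / 2 = nuOf p + k + 1 := by
    unfold nuOf; push_cast; ring
  rw [e] at h
  have hg : 0 < Real.Gamma (nuOf p + k + 1) :=
    Real.Gamma_pos_of_pos (by rw [← e]; positivity)
  have hG := vmfaux_gamma k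
  have hpi : √π ^ (p - 1) * √π = π ^ ((p : ℝ) / 2) := by
    rw [← pow_succ, Nat.sub_add_cancel hp, Real.sqrt_eq_rpow, ← Real.rpow_natCast,
      ← Real.rpow_mul pi_pos.le]
    congr 1; ring
  have h4 : (2 : ℝ) ^ (2 * k) = 4 ^ k := by rw [pow_mul]; norm_num
  rw [div_pow, h4, ← hpi]
  have hf : ((2 * k).factorial : ℝ) ≠ 0 := by positivity
  have hf' : (k.factorial : ℝ) ≠ 0 := by positivity
  field_simp
  generalize (∫ x : Metric.sphere (0 : EuclideanSpace ℝ (Fin p)) 1,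
          ⟪a, (x : EuclideanSpace ℝ (Fin p))⟫ ^ (2 * k) ∂(sphereMeasure p)) = M at *
  linear_combination (-2 * 4 ^ k * (k.factorial : ℝ)) * h + 2 * ‖a‖ ^ (2 * k) * √π ^ (p - 1) * hG

lemma vmfaux_exp (p : ℕ) (hp : 0 < p) (a : EuclideanSpace ℝ (Fin p)) (ha : a ≠ 0) :
    ∫ x : Metric.sphere (0 : EuclideanSpace ℝ (Fin p)) 1,
          Real.exp ⟪a, (x : EuclideanSpace ℝ (Fin p))⟫ ∂(sphereMeasure p)
      = vmfC (nuOf p) ‖a‖ := by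
  haveI : IsFiniteMeasure (sphereMeasure p) := by unfold sphereMeasure; infer_instance
  have hcont : ∀ n : ℕ, Continuous (fun x : Metric.sphere (0 : EuclideanSpace ℝ (Fin p)) 1 =>
      ⟪a, (x : EuclideanSpace ℝ (Fin p))⟫ ^ n / (n.factorial : ℝ)) := by
    intro n; fun_prop
  have hbd : ∀ (n : ℕ) (x : Metric.sphere (0 : EuclideanSpace ℝ (Fin p)) 1),
      ‖⟪a, (x : EuclideanSpace ℝ (Fin p))⟫ ^ n / (n.factorial : ℝ)‖ ≤ ‖a‖ ^ n / n.factorial := by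
    intro n x
    rw [norm_div, norm_pow, Real.norm_natCast]
    gcongr
    have := norm_inner_le_norm (𝕜 := ℝ) a (x : EuclideanSpace ℝ (Fin p))
    rwa [norm_eq_of_mem_sphere x, mul_one] at this
  have hint : ∀ n : ℕ, Integrable (fun x : Metric.sphere (0 : EuclideanSpace ℝ (Fin p)) 1 =>
      ⟪a, (x : EuclideanSpace ℝ (Fin p))⟫ ^ n / (n.factorial : ℝ)) (sphereMeasure p) := fun n =>
    Integrable.of_bound (hcont n).aestronglyMeasurable _ (Filter.Eventually.of_forall (hbd n))
  have hs := hasSum_integral_of_summable_integral_norm hint (by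
    refine Summable.of_nonneg_of_le (fun n => integral_nonneg fun x => norm_nonneg _)
      (fun n => ?_) ((Real.summable_pow_div_factorial ‖a‖).mul_left ((sphereMeasure p).real Set.univ))
    refine (integral_mono (hint n).norm (integrable_const _) (hbd n)).trans ?_
    simp)
  have hexp : ∀ t : ℝ, ∑' n : ℕ, t ^ n / (n.factorial : ℝ) = Real.exp t := by
    intro t
    rw [Real.exp_eq_exp_ℝ]
    exact (NormedSpace.expSeries_div_hasSum_exp t).tsum_eq
  simp only [hexp, integral_div] at hs
  rw [← (show Function.Injective (fun k : ℕ => 2 * k) from fun i j h => by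
    simpa using h).hasSum_iff] at hs
  · simp only [Function.comp_def, vmfaux_moment_even p hp a ha] at hs
    rw [← hs.tsum_eq, tsum_mul_left]
    unfold vmfC besselI
    have hna : 0 < ‖a‖ := norm_pos_iff.mpr ha
    have e : nuOf p + 1 = (p : ℝ) / 2 := by unfold nuOf; ring
    have h2 : (2 : ℝ) ^ ((p : ℝ) / 2) = 2 ^ nuOf p * 2 := by
      rw [← e, Real.rpow_add_one (by norm_num)]
    rw [e, Real.mul_rpow (by norm_num) pi_pos.le, Real.div_rpow hna.le (by norm_num), h2]
    have : ‖a‖ ^ nuOf p ≠ 0 := (Real.rpow_pos_of_pos hna _).ne'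
    have : (2 : ℝ) ^ nuOf p ≠ 0 := (Real.rpow_pos_of_pos two_pos _).ne'
    field_simp
  · intro n hn
    have : Odd n := by
      rw [← Nat.not_even_iff_odd]
      rintro ⟨m, rfl⟩
      exact hn ⟨m, by simp; ring⟩
    rw [vmfaux_moment_odd p hp a ha n this, zero_div]

/-- χ-square distance between two von Mises–Fisher distributions when `κ_χ > 0`. -/
theorem chisq_distance_vmf (p : ℕ) (hp : 2 ≤ p)
    (κy κz : ℝ) (hκy : 0 < κy) (hκz : 0 < κz)
    (μy μz : EuclideanSpace ℝ (Fin p)) (hμy : ‖μy‖ = 1) (hμz : ‖μz‖ = 1)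
    (κχ : ℝ) (hκχ : κχ = ‖(2 * κy) • μy - κz • μz‖) (hκχpos : 0 < κχ) :
    chiSqDist p κy κz μy μz
      = κy ^ (2 * nuOf p) * besselI (nuOf p) κχ * besselI (nuOf p) κz
          / (κχ ^ nuOf p * κz ^ nuOf p * besselI (nuOf p) κy ^ 2) - 1 := by
  have hp0 : 0 < p := by omega
  set a := (2 * κy) • μy - κz • μz with hadef
  have ha : a ≠ 0 := norm_pos_iff.mp (hκχ ▸ hκχpos)
  have hE := vmfaux_exp p hp0 a ha
  rw [← hκχ] at hE
  unfold chiSqDist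
  congr 1
  have hpt : ∀ x : EuclideanSpace ℝ (Fin p), vmf p κy μy x ^ 2 / vmf p κz μz x
      = (vmfC (nuOf p) κz / vmfC (nuOf p) κy ^ 2) * Real.exp ⟪a, x⟫ := by
    intro x
    have h1 : ⟪a, x⟫ = κy * ⟪μy, x⟫ + κy * ⟪μy, x⟫ - κz * ⟪μz, x⟫ := by
      rw [hadef, inner_sub_left, real_inner_smul_left, real_inner_smul_left]; ring
    unfold vmf
    rw [h1, Real.exp_sub, Real.exp_add, div_pow, div_div_div_eq, sq (Real.exp _)]
    ring
  simp_rw [hpt]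
  rw [integral_const_mul, hE]
  unfold vmfC
  have h2 : κy ^ (2 * nuOf p) = (κy ^ nuOf p) ^ 2 := by
    rw [mul_comm, Real.rpow_mul hκy.le]; norm_num
  rw [h2]
  have e1 : κy ^ nuOf p ≠ 0 := (Real.rpow_pos_of_pos hκy _).ne'
  have e2 : κz ^ nuOf p ≠ 0 := (Real.rpow_pos_of_pos hκz _).ne'
  have e3 : κχ ^ nuOf p ≠ 0 := (Real.rpow_pos_of_pos hκχpos _).ne'
  have e4 : (2 * π) ^ (nuOf p + 1) ≠ 0 := (Real.rpow_pos_of_pos (by positivity) _).ne'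
  by_cases hI : besselI (nuOf p) κy = 0
  · simp [hI]
  · field_simp
end

section
/- Let y be a von Mises–Fisher random vector on S_p with parameters (κ_y, μ_y) and let z be uniformly distributed on S_p. Then the squared-Hellinger distance between y and z equals d_h(y,z)² = 2·(1 − 2^{3ν/2}·I_ν(κ_y/2)·Γ(ν+1)^{1/2}/(κ_y^{ν/2}·I_ν(κ_y)^{1/2})). -/
open MeasureTheory Real
open scoped RealInnerProductSpace

/-- The squared-Hellinger distance between `f_p(·;κ_y,μ_y)` and the uniform
distribution on the sphere. -/
noncomputable def hellingerSqUniform (p : ℕ) (κy : ℝ) (μy : EuclideanSpace ℝ (Fin p)) : ℝ :=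
  2 * (1 - ∫ x : Metric.sphere (0 : EuclideanSpace ℝ (Fin p)) 1,
      (vmf p κy μy (x : EuclideanSpace ℝ (Fin p)) * uniformDensity p) ^ ((1 : ℝ) / 2)
      ∂(sphereMeasure p))

open Set in
/-- One-dimensional Gaussian moment (odd case). -/
lemma gauss_moment_odd (k : ℕ) : ∫ s : ℝ, s ^ (2 * k + 1) * Real.exp (-s ^ 2) = 0 := by
  have h := MeasureTheory.integral_neg_eq_self (fun s : ℝ => s ^ (2 * k + 1) * Real.exp (-s ^ 2)) volume
  have h2 : ∀ s : ℝ, (-s) ^ (2 * k + 1) * Real.exp (-(-s) ^ 2)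
      = - (s ^ (2 * k + 1) * Real.exp (-s ^ 2)) := by
    intro s
    rw [Odd.neg_pow ⟨k, rfl⟩, neg_sq]; ring
  simp only [h2] at h
  rw [integral_neg] at h
  linarith

open Set in
lemma radial_moment (n : ℕ) :
    ∫ r in Ioi (0 : ℝ), r ^ n * Real.exp (-r ^ 2) = Real.Gamma (((n : ℝ) + 1) / 2) / 2 := by
  have h := integral_rpow_mul_exp_neg_rpow (p := 2) (q := n) (by norm_num)
    (by have : (0 : ℝ) ≤ n := n.cast_nonneg
        linarith)
  simp only [Real.rpow_natCast, Real.rpow_two] at h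
  rw [h]; ring

open Set in
lemma gauss_moment_even (k : ℕ) :
    ∫ s : ℝ, s ^ (2 * k) * Real.exp (-s ^ 2) = Real.Gamma (k + 1 / 2) := by
  have h := integral_comp_abs (f := fun s : ℝ => s ^ (2 * k) * Real.exp (-s ^ 2))
  simp only [sq_abs, pow_mul] at h
  simp only [← pow_mul] at h
  rw [h, radial_moment]
  push_cast
  rw [show ((2 * k + 1 : ℝ)) / 2 = k + 1 / 2 by ring]
  ring

lemma gauss_moment_zero : ∫ s : ℝ, Real.exp (-s ^ 2) = Real.sqrt Real.pi := by
  have := integral_gaussian 1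
  simpa using this

/-- Gaussian moment in direction `μ` on `ℝ^p`. -/
lemma gauss_moment_dir (q : ℕ) (μ : EuclideanSpace ℝ (Fin (q + 1))) (hμ : ‖μ‖ = 1) (n : ℕ) :
    ∫ x : EuclideanSpace ℝ (Fin (q + 1)), ⟪μ, x⟫ ^ n * Real.exp (-‖x‖ ^ 2)
      = (∫ s : ℝ, s ^ n * Real.exp (-s ^ 2)) * Real.sqrt Real.pi ^ q := by
  obtain ⟨b, hb⟩ := Orthonormal.exists_orthonormalBasis_extension_of_card_eq (𝕜 := ℝ)
    (E := EuclideanSpace ℝ (Fin (q + 1))) (ι := Fin (q + 1)) (by simp)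
    (v := fun _ => μ) (s := {0}) (by
      constructor
      · intro i; simpa using hμ
      · intro i j hij
        exact absurd (Subsingleton.elim i j) hij)
  have hb0 : b 0 = μ := hb 0 rfl
  have key := (b.measurePreserving_repr_symm).integral_comp
    b.repr.symm.toHomeomorph.measurableEmbedding
    (fun x : EuclideanSpace ℝ (Fin (q + 1)) => ⟪μ, x⟫ ^ n * Real.exp (-‖x‖ ^ 2))
  rw [← key]
  have h1 : ∀ y : EuclideanSpace ℝ (Fin (q + 1)),
      ⟪μ, b.repr.symm y⟫ ^ n * Real.exp (-‖b.repr.symm y‖ ^ 2)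
       = ∏ i, (if i = 0 then fun s : ℝ => s ^ n * Real.exp (-s ^ 2)
          else fun s : ℝ => Real.exp (-s ^ 2)) (y i) := by
    intro y
    rw [LinearIsometryEquiv.norm_map, ← hb0, ← b.repr_apply_apply,
      LinearIsometryEquiv.apply_symm_apply, EuclideanSpace.norm_sq_eq, Fin.prod_univ_succ,
      Fin.sum_univ_succ]
    simp [Fin.succ_ne_zero, Real.exp_add, ← Finset.sum_neg_distrib, Real.exp_sum]
    ring
  simp only [h1]
  have key2 := (PiLp.volume_preserving_ofLp (Fin (q + 1))).integral_comp
    (MeasurableEquiv.toLp 2 (Fin (q + 1) → ℝ)).symm.measurableEmbedding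
    (fun y : Fin (q + 1) → ℝ => ∏ i, (if i = 0 then fun s : ℝ => s ^ n * Real.exp (-s ^ 2)
          else fun s : ℝ => Real.exp (-s ^ 2)) (y i))
  refine key2.trans ?_
  rw [integral_fintype_prod_volume_eq_prod, Fin.prod_univ_succ]
  simp [Fin.succ_ne_zero, gauss_moment_zero]

open Set in
/-- Polar coordinates for the Gaussian moment. -/
lemma gauss_moment_polar (q : ℕ) (μ : EuclideanSpace ℝ (Fin (q + 1))) (n : ℕ) :
    ∫ x : EuclideanSpace ℝ (Fin (q + 1)), ⟪μ, x⟫ ^ n * Real.exp (-‖x‖ ^ 2)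
      = (∫ x : Metric.sphere (0 : EuclideanSpace ℝ (Fin (q + 1))) 1,
          ⟪μ, (x : EuclideanSpace ℝ (Fin (q + 1)))⟫ ^ n ∂(sphereMeasure (q + 1)))
        * (Real.Gamma (((n : ℝ) + q + 1) / 2) / 2) := by
  have hdim : Module.finrank ℝ (EuclideanSpace ℝ (Fin (q + 1))) - 1 = q := by simp
  calc
    _ = ∫ x : ({(0)}ᶜ : Set (EuclideanSpace ℝ (Fin (q + 1)))), ⟪μ, x.1⟫ ^ n * Real.exp (-‖x.1‖ ^ 2)
        ∂((volume : Measure (EuclideanSpace ℝ (Fin (q + 1)))).comap (↑)) := by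
      rw [integral_subtype_comap (measurableSet_singleton _).compl
        fun x : (EuclideanSpace ℝ (Fin (q + 1))) ↦ ⟪μ, x⟫ ^ n * Real.exp (-‖x‖ ^ 2), restrict_compl_singleton]
    _ = ∫ x : Metric.sphere (0 : (EuclideanSpace ℝ (Fin (q + 1)))) 1 × Ioi (0 : ℝ),
          ⟪μ, x.1.1⟫ ^ n * (x.2.1 ^ n * Real.exp (-x.2.1 ^ 2))
          ∂(volume : Measure (EuclideanSpace ℝ (Fin (q + 1)))).toSphere.prod (.volumeIoiPow (Module.finrank ℝ (EuclideanSpace ℝ (Fin (q + 1))) - 1)) := by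
      rw [← (volume : Measure (EuclideanSpace ℝ (Fin (q + 1)))).measurePreserving_homeomorphUnitSphereProd.integral_comp
        (Homeomorph.measurableEmbedding _)]
      refine integral_congr_ae (Filter.Eventually.of_forall fun x => ?_)
      have hx : ‖x.1‖ ≠ 0 := norm_ne_zero_iff.2 x.2
      simp only [homeomorphUnitSphereProd_apply_fst_coe, homeomorphUnitSphereProd_apply_snd_coe,
        inner_smul_right]
      rw [mul_pow, inv_pow]
      field_simp
    _ = _ := by
      rw [integral_prod_mul (μ := (volume : Measure (EuclideanSpace ℝ (Fin (q + 1)))).toSphere)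
        (fun x : Metric.sphere (0 : (EuclideanSpace ℝ (Fin (q + 1)))) 1 => ⟪μ, x.1⟫ ^ n)
        (fun r : Ioi (0 : ℝ) => r.1 ^ n * Real.exp (-r.1 ^ 2)), hdim]
      congr 1
      simp only [Measure.volumeIoiPow, ENNReal.ofReal]
      rw [integral_withDensity_eq_integral_smul,
        integral_subtype_comap measurableSet_Ioi
          fun a : ℝ ↦ Real.toNNReal (a ^ q) • (a ^ n * Real.exp (-a ^ 2)),
        setIntegral_congr_fun (g := fun a : ℝ => a ^ (n + q) * Real.exp (-a ^ 2))
          measurableSet_Ioi fun x hx ↦ ?_]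
      · rw [radial_moment]; push_cast; rfl
      · rw [NNReal.smul_def, Real.coe_toNNReal _ (pow_nonneg (le_of_lt hx) _), smul_eq_mul]
        ring
      · exact (measurable_subtype_coe.pow_const _).real_toNNReal

lemma sphere_moment_odd (q : ℕ) (μ : EuclideanSpace ℝ (Fin (q + 1))) (hμ : ‖μ‖ = 1) (k : ℕ) :
    ∫ x : Metric.sphere (0 : EuclideanSpace ℝ (Fin (q + 1))) 1,
          ⟪μ, (x : EuclideanSpace ℝ (Fin (q + 1)))⟫ ^ (2 * k + 1) ∂(sphereMeasure (q + 1)) = 0 := by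
  have h := gauss_moment_polar q μ (2 * k + 1)
  rw [gauss_moment_dir q μ hμ, gauss_moment_odd, zero_mul] at h
  have hG : 0 < Real.Gamma ((((2 * k + 1 : ℕ) : ℝ) + q + 1) / 2) :=
    Real.Gamma_pos_of_pos (by positivity)
  rcases mul_eq_zero.1 h.symm with h | h
  · exact h
  · exact absurd h (by positivity)

lemma gamma_half (k : ℕ) :
    Real.Gamma (k + 1 / 2) * (4 ^ k * Nat.factorial k) = Nat.factorial (2 * k) * Real.sqrt π := by
  induction k with
  | zero => simp [one_div]; rw [← one_div, Real.Gamma_one_half_eq]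
  | succ k ih =>
    have h1 : Real.Gamma ((k + 1 : ℕ) + 1 / 2) = (k + 1 / 2) * Real.Gamma (k + 1 / 2) := by
      rw [← Real.Gamma_add_one (by positivity)]
      push_cast; ring_nf
    rw [h1, show 2 * (k + 1) = 2 * k + 1 + 1 by ring, Nat.factorial_succ, Nat.factorial_succ,
      Nat.factorial_succ]
    push_cast
    linear_combination (2 * (k : ℝ) + 1) * (2 * k + 2) * ih

lemma nuOf_succ (q : ℕ) : nuOf (q + 1) + 1 = ((q : ℝ) + 1) / 2 := by
  unfold nuOf; push_cast; ring

lemma sphere_moment_even (q : ℕ) (μ : EuclideanSpace ℝ (Fin (q + 1))) (hμ : ‖μ‖ = 1) (k : ℕ) :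
    ∫ x : Metric.sphere (0 : EuclideanSpace ℝ (Fin (q + 1))) 1,
          ⟪μ, (x : EuclideanSpace ℝ (Fin (q + 1)))⟫ ^ (2 * k) ∂(sphereMeasure (q + 1))
      = 2 * π ^ (nuOf (q + 1) + 1) * (Nat.factorial (2 * k) / (4 ^ k * Nat.factorial k
          * Real.Gamma (nuOf (q + 1) + k + 1))) := by
  have h := gauss_moment_polar q μ (2 * k)
  rw [gauss_moment_dir q μ hμ, gauss_moment_even] at h
  have e : (((2 * k : ℕ) : ℝ) + q + 1) / 2 = nuOf (q + 1) + k + 1 := by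
    unfold nuOf; push_cast; ring
  rw [e] at h
  have hG : 0 < Real.Gamma (nuOf (q + 1) + k + 1) :=
    Real.Gamma_pos_of_pos (by rw [add_right_comm, nuOf_succ]; positivity)
  have hpi : π ^ (nuOf (q + 1) + 1) = Real.sqrt π ^ (q + 1) := by
    rw [nuOf_succ, Real.sqrt_eq_rpow, ← Real.rpow_natCast, ← Real.rpow_mul Real.pi_pos.le]
    push_cast; ring_nf
  have hg := gamma_half k
  rw [hpi]
  have hf : (0 : ℝ) < Nat.factorial k := by positivity
  field_simp
  rw [pow_succ]
  generalize (∫ x : Metric.sphere (0 : EuclideanSpace ℝ (Fin (q + 1))) 1,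
          ⟪μ, (x : EuclideanSpace ℝ (Fin (q + 1)))⟫ ^ (2 * k) ∂(sphereMeasure (q + 1))) = M at *
  linear_combination (-2 * 4 ^ k * (Nat.factorial k : ℝ)) * h + 2 * √π ^ q * hg

/-- The partition function integral. -/
lemma sphere_exp (q : ℕ) (μ : EuclideanSpace ℝ (Fin (q + 1))) (hμ : ‖μ‖ = 1) (t : ℝ)
    (ht : 0 < t) :
    ∫ x : Metric.sphere (0 : EuclideanSpace ℝ (Fin (q + 1))) 1,
          Real.exp (t * ⟪μ, (x : EuclideanSpace ℝ (Fin (q + 1)))⟫) ∂(sphereMeasure (q + 1))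
      = vmfC (nuOf (q + 1)) t := by
  have : IsFiniteMeasure (sphereMeasure (q + 1)) := by unfold sphereMeasure; infer_instance
  have hin : ∀ x : Metric.sphere (0 : EuclideanSpace ℝ (Fin (q + 1))) 1,
      |⟪μ, (x : EuclideanSpace ℝ (Fin (q + 1)))⟫| ≤ 1 := by
    intro x
    have := abs_real_inner_le_norm μ (x : EuclideanSpace ℝ (Fin (q + 1)))
    have hx : ‖(x : EuclideanSpace ℝ (Fin (q + 1)))‖ = 1 := by simp
    rwa [hμ, hx, one_mul] at this
  have hs := hasSum_integral_of_dominated_convergence (μ := sphereMeasure (q + 1))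
    (F := fun n x => (t * ⟪μ, (x : EuclideanSpace ℝ (Fin (q + 1)))⟫) ^ n / Nat.factorial n)
    (f := fun x => Real.exp (t * ⟪μ, (x : EuclideanSpace ℝ (Fin (q + 1)))⟫))
    (fun n _ => t ^ n / Nat.factorial n)
    (fun n => by
      apply Continuous.aestronglyMeasurable
      fun_prop)
    (fun n => Filter.Eventually.of_forall fun x => by
      rw [norm_div, norm_pow, norm_mul, Real.norm_eq_abs t, abs_of_pos ht, Real.norm_natCast]
      gcongr
      exact mul_le_of_le_one_right ht.le (hin x))
    (Filter.Eventually.of_forall fun _ => Real.summable_pow_div_factorial t)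
    (integrable_const _)
    (Filter.Eventually.of_forall fun x => by
      have := NormedSpace.expSeries_div_hasSum_exp
        (t * ⟪μ, (x : EuclideanSpace ℝ (Fin (q + 1)))⟫)
      rwa [← Real.exp_eq_exp_ℝ] at this)
  simp only [mul_pow, mul_div_right_comm, integral_const_mul] at hs
  have hinj : Function.Injective (fun k : ℕ => 2 * k) := fun a b h => by simpa using h
  rw [← hinj.hasSum_iff] at hs
  · rw [← hs.tsum_eq]
    unfold vmfC besselI
    have e : (2 * π) ^ (nuOf (q + 1) + 1) * ((t / 2) ^ nuOf (q + 1) *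
        ∑' k : ℕ, (t / 2) ^ (2 * k) / (Nat.factorial k * Real.Gamma (nuOf (q + 1) + k + 1)))
          / t ^ nuOf (q + 1) = 2 * π ^ (nuOf (q + 1) + 1) * 
          ∑' k : ℕ, (t / 2) ^ (2 * k) / (Nat.factorial k * Real.Gamma (nuOf (q + 1) + k + 1)) := by
      rw [Real.mul_rpow (by norm_num) Real.pi_pos.le, Real.div_rpow ht.le (by norm_num),
        Real.rpow_add_one (by norm_num : (2 : ℝ) ≠ 0)]
      have h1 : 0 < t ^ nuOf (q + 1) := by positivity
      have h2 : (0 : ℝ) < 2 ^ nuOf (q + 1) := by positivity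
      field_simp
    rw [e, ← tsum_mul_left]
    refine tsum_congr fun k => ?_
    simp only [Function.comp]
    rw [sphere_moment_even q μ hμ, div_pow, pow_mul 2 2 k]
    have hf : (0 : ℝ) < Nat.factorial (2 * k) := by positivity
    norm_num
    field_simp
  · intro n hn
    rcases Nat.even_or_odd' n with ⟨k, rfl | rfl⟩
    · exact absurd ⟨k, rfl⟩ hn
    · rw [sphere_moment_odd q μ hμ, mul_zero]

lemma besselI_nonneg (q : ℕ) (t : ℝ) (ht : 0 < t) : 0 ≤ besselI (nuOf (q + 1)) t := by
  unfold besselI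
  refine mul_nonneg (by positivity) (tsum_nonneg fun k => ?_)
  have hG : 0 < Real.Gamma (nuOf (q + 1) + k + 1) :=
    Real.Gamma_pos_of_pos (by rw [add_right_comm, nuOf_succ]; positivity)
  positivity

/-- Squared-Hellinger distance between a von Mises–Fisher distribution and the
uniform distribution on the sphere. -/
theorem hellinger_sq_vmf_uniform (p : ℕ) (hp : 2 ≤ p)
    (κy : ℝ) (hκy : 0 < κy)
    (μy : EuclideanSpace ℝ (Fin p)) (hμy : ‖μy‖ = 1) :
    hellingerSqUniform p κy μy
      = 2 * (1 - 2 ^ (3 * nuOf p / 2) * besselI (nuOf p) (κy / 2)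
          * Real.Gamma (nuOf p + 1) ^ ((1 : ℝ) / 2)
          / (κy ^ (nuOf p / 2) * besselI (nuOf p) κy ^ ((1 : ℝ) / 2))) := by
  obtain ⟨q, rfl⟩ : ∃ q, p = q + 1 := ⟨p - 1, by omega⟩
  unfold hellingerSqUniform
  congr 2
  have hI := besselI_nonneg q κy hκy
  have hG : 0 < Real.Gamma (nuOf (q + 1) + 1) :=
    Real.Gamma_pos_of_pos (by rw [nuOf_succ]; positivity)
  have hC : 0 ≤ vmfC (nuOf (q + 1)) κy := by unfold vmfC; positivity
  have hu : 0 ≤ uniformDensity (q + 1) := by unfold uniformDensity; positivity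
  have h1 : ∀ x : EuclideanSpace ℝ (Fin (q + 1)),
      (vmf (q + 1) κy μy x * uniformDensity (q + 1)) ^ ((1 : ℝ) / 2)
      = Real.exp (κy / 2 * ⟪μy, x⟫)
        * (uniformDensity (q + 1) / vmfC (nuOf (q + 1)) κy) ^ ((1 : ℝ) / 2) := by
    intro x
    unfold vmf
    rw [div_mul_eq_mul_div, mul_div_assoc,
      Real.mul_rpow (Real.exp_pos _).le (div_nonneg hu hC), ← Real.exp_mul]
    ring_nf
  simp only [h1]
  rw [integral_mul_const, sphere_exp q μy hμy _ (by positivity)]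
  unfold vmfC uniformDensity
  generalize besselI (nuOf (q + 1)) κy = I at *
  generalize besselI (nuOf (q + 1)) (κy / 2) = J at *
  generalize Real.Gamma (nuOf (q + 1) + 1) = G at *
  generalize nuOf (q + 1) = ν at *
  have e1 : G / (2 * π ^ (ν + 1)) / ((2 * π) ^ (ν + 1) * I / κy ^ ν)
      = G * κy ^ ν * 2 ^ ν / (((2 * π) ^ (ν + 1)) ^ (2 : ℝ) * I) := by
    rw [Real.rpow_two, Real.mul_rpow (by norm_num) Real.pi_pos.le,
      Real.rpow_add_one (by norm_num : (2 : ℝ) ≠ 0)]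
    have h1 : 0 < κy ^ ν := by positivity
    have h2 : (0 : ℝ) < 2 ^ ν := by positivity
    have h3 : (0 : ℝ) < π ^ (ν + 1) := by positivity
    rcases hI.eq_or_lt with h | h
    · simp [← h]
    field_simp
  have e2 : (G / (2 * π ^ (ν + 1)) / ((2 * π) ^ (ν + 1) * I / κy ^ ν)) ^ ((1 : ℝ) / 2)
      = G ^ ((1 : ℝ) / 2) * κy ^ (ν / 2) * 2 ^ (ν / 2) / ((2 * π) ^ (ν + 1) * I ^ ((1 : ℝ) / 2)) := by
    rw [e1, Real.div_rpow (by positivity) (by positivity), Real.mul_rpow (by positivity) hI,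
      Real.mul_rpow (by positivity) (by positivity), Real.mul_rpow (by positivity) (by positivity),
      ← Real.rpow_mul (by positivity), ← Real.rpow_mul (by positivity),
      ← Real.rpow_mul (by positivity : 0 ≤ (2 * π) ^ (ν + 1))]
    norm_num [div_eq_mul_inv]
  rw [e2, Real.div_rpow hκy.le (by norm_num),
    show 3 * ν / 2 = ν + ν / 2 by ring, Real.rpow_add (by norm_num : (0 : ℝ) < 2)]
  have e3 : κy ^ ν = κy ^ (ν / 2) * κy ^ (ν / 2) := by rw [← Real.rpow_add hκy]; ring_nf
  rw [e3]
  have h1 : 0 < κy ^ (ν / 2) := by positivity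
  have h2 : (0 : ℝ) < 2 ^ ν := by positivity
  have h3 : (0 : ℝ) < (2 * π) ^ (ν + 1) := by positivity
  rcases (Real.rpow_nonneg hI ((1 : ℝ) / 2)).eq_or_lt with h | h
  · simp only [← h]; simp
  field_simp
end
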